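/- Let C_a > 0, θ ≥ 0 and let g : 𝕋 → ℝ be continuous; set a := C_a + θg and assume a is even and a(x) > 0 for all x ∈ 𝕋. Let v̄ > 0, T > 0, let w : 𝕋 × [0,T] → ℝ be smooth with 0 < w_min ≤ w(x,t) ≤ w_max for all (x,t), and let (ρ, j) be a classical solution of the weighted reduced Cucker–Smale PDE with kernel a, parameter v̄ and weight w on [0,T], satisfying ∫_𝕋 ρ(x,0)dx = 1 and ∫_𝕋 j(x,0)dx = v̄. Let Q > 0 satisfy 8θ‖g‖Q < C_a and suppose v̄²‖ρ(·,t)‖² + ‖j(·,t)‖² ≤ v̄²Q² for all t ∈ [0,T]. Define R(t) := ⟨ j(·,t) − v̄ρ(·,t), j(·,t) − v̄ w(·,t)ρ(·,t) ⟩ and β̃(s) := 2v̄²Q²( v̄‖∂_x w(·,s)‖_∞ + ‖∂_t w(·,s)‖_∞ ) + v̄²θ‖g‖Q³‖1 − w(·,s)‖_∞. Then for all t ∈ [0,T]: R(t) ≤ R(0) e^{−C_a t} + e^{−C_a t} ∫₀ᵗ e^{C_a s} β̃(s) ds. -/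

import Mathlib

open Real MeasureTheory

/-- Convolution on the torus `ℝ/2πℤ`, with functions represented as `2π`-periodic
functions on `ℝ` and the integral taken over one period. -/
noncomputable def conv1 (f h : ℝ → ℝ) (x : ℝ) : ℝ :=
  ∫ y in (0:ℝ)..(2*π), f (x - y) * h y

/-- `L²(𝕋)` inner product. -/
noncomputable def ip (f h : ℝ → ℝ) : ℝ :=
  ∫ x in (0:ℝ)..(2*π), f x * h x

/-- `L²(𝕋)` norm. -/
noncomputable def nrm (f : ℝ → ℝ) : ℝ := Real.sqrt (ip f f)

/-- Supremum norm of a function on the torus (represented as a function on `ℝ`). -/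
noncomputable def supNorm (f : ℝ → ℝ) : ℝ := ⨆ x : ℝ, |f x|

/-- A classical solution of the weighted reduced Cucker-Smale PDE with kernel `a`,
parameter `vbar` and weight `w` on the time interval `I`: smooth `2π`-periodic-in-`x`
functions `ρ, j` satisfying `∂ₜρ = −∂ₓj` and `∂ₜj = ρ(a∗j) − j(a∗ρ) − vbar²∂ₓ(wρ)`. -/
structure IsWeightedSol (a : ℝ → ℝ) (vbar : ℝ) (w ρ j : ℝ → ℝ → ℝ) (I : Set ℝ) : Prop where
  periodic_rho : ∀ t ∈ I, Function.Periodic (fun x => ρ x t) (2*π)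
  periodic_j : ∀ t ∈ I, Function.Periodic (fun x => j x t) (2*π)
  smooth_rho : ContDiffOn ℝ (⊤ : ℕ∞) (fun p : ℝ × ℝ => ρ p.1 p.2) (Set.univ ×ˢ I)
  smooth_j : ContDiffOn ℝ (⊤ : ℕ∞) (fun p : ℝ × ℝ => j p.1 p.2) (Set.univ ×ˢ I)
  pde_rho : ∀ (x : ℝ), ∀ t ∈ I,
    derivWithin (fun s => ρ x s) I t = - deriv (fun y => j y t) x
  pde_j : ∀ (x : ℝ), ∀ t ∈ I,
    derivWithin (fun s => j x s) I t =
      ρ x t * conv1 a (fun y => j y t) x - j x t * conv1 a (fun y => ρ y t) x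
        - vbar ^ 2 * deriv (fun y => w y t * ρ y t) x


lemma aux_two_pi_nonneg : (0:ℝ) ≤ 2 * π := by positivity

lemma aux_ip_nonneg (f : ℝ → ℝ) : 0 ≤ ip f f :=
  intervalIntegral.integral_nonneg aux_two_pi_nonneg (fun _ _ => mul_self_nonneg _)

lemma aux_nrm_nonneg (f : ℝ → ℝ) : 0 ≤ nrm f := Real.sqrt_nonneg _

lemma aux_nrm_sq (f : ℝ → ℝ) : nrm f ^ 2 = ∫ x in (0:ℝ)..(2*π), f x ^ 2 := by
  rw [nrm, Real.sq_sqrt (aux_ip_nonneg f), ip]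
  simp only [sq]

/-- Cauchy-Schwarz. -/
lemma aux_cs (f h : ℝ → ℝ) (hf : Continuous f) (hh : Continuous h) :
    |∫ x in (0:ℝ)..(2*π), f x * h x| ≤ nrm f * nrm h := by
  have key : ∀ l : ℝ, 0 ≤ nrm h ^ 2 * (l * l) + (2 * ∫ x in (0:ℝ)..(2*π), f x * h x) * l
      + nrm f ^ 2 := by
    intro l
    have h0 : 0 ≤ ∫ x in (0:ℝ)..(2*π), (f x + l * h x) ^ 2 :=
      intervalIntegral.integral_nonneg aux_two_pi_nonneg (fun x _ => sq_nonneg _)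
    have h1 : ∫ x in (0:ℝ)..(2*π), (f x + l * h x) ^ 2
        = (∫ x in (0:ℝ)..(2*π), f x ^ 2) + 2 * l * (∫ x in (0:ℝ)..(2*π), f x * h x)
          + l ^ 2 * ∫ x in (0:ℝ)..(2*π), h x ^ 2 := by
      rw [← intervalIntegral.integral_const_mul, ← intervalIntegral.integral_const_mul,
        ← intervalIntegral.integral_add, ← intervalIntegral.integral_add]
      · congr 1; ext x; ring
      all_goals exact Continuous.intervalIntegrable (by fun_prop) _ _
    rw [aux_nrm_sq, aux_nrm_sq]
    nlinarith
  have := discrim_le_zero key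
  rw [discrim] at this
  apply abs_le_of_sq_le_sq _ (mul_nonneg (aux_nrm_nonneg _) (aux_nrm_nonneg _))
  nlinarith

lemma aux_cs_abs (f h : ℝ → ℝ) (hf : Continuous f) (hh : Continuous h) :
    ∫ x in (0:ℝ)..(2*π), |f x| * |h x| ≤ nrm f * nrm h := by
  have := (le_abs_self _).trans (aux_cs (fun x => |f x|) (fun x => |h x|) hf.abs hh.abs)
  simpa only [nrm, ip, abs_mul_abs_self] using this

lemma aux_conv_bound (g h : ℝ → ℝ) (hg : Continuous g) (hgp : Function.Periodic g (2*π))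
    (hh : Continuous h) (x : ℝ) : |conv1 g h x| ≤ nrm g * nrm h := by
  have := aux_cs (fun y => g (x - y)) h (by fun_prop) hh
  have e : nrm (fun y => g (x - y)) = nrm g := by
    simp only [nrm, ip]
    congr 1
    rw [intervalIntegral.integral_comp_sub_left (fun y => g y * g y)]
    have hp : Function.Periodic (fun y => g y * g y) (2*π) := hgp.mul hgp
    have := hp.intervalIntegral_add_eq (x - 2*π) 0
    simpa using this
  rwa [e] at this

lemma aux_conv_cont (g h : ℝ → ℝ) (hg : Continuous g) (hh : Continuous h) :
    Continuous (conv1 g h) := by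
  unfold conv1
  apply intervalIntegral.continuous_parametric_intervalIntegral_of_continuous'
  simp only [Function.uncurry_def]
  fun_prop

lemma aux_conv_affine (Ca θ : ℝ) (g h : ℝ → ℝ) (hg : Continuous g) (hh : Continuous h) (x : ℝ) :
    conv1 (fun x => Ca + θ * g x) h x
      = Ca * (∫ y in (0:ℝ)..(2*π), h y) + θ * conv1 g h x := by
  unfold conv1
  rw [← intervalIntegral.integral_const_mul, ← intervalIntegral.integral_const_mul,
        ← intervalIntegral.integral_add]
  · congr 1; ext y; ring
  all_goals exact Continuous.intervalIntegrable (by fun_prop) _ _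

lemma aux_conv_sub (g h k : ℝ → ℝ) (v : ℝ) (hg : Continuous g) (hh : Continuous h)
    (hk : Continuous k) (x : ℝ) :
    conv1 g (fun y => h y - v * k y) x = conv1 g h x - v * conv1 g k x := by
  unfold conv1
  rw [← intervalIntegral.integral_const_mul, ← intervalIntegral.integral_sub]
  · congr 1; ext y; ring
  all_goals exact Continuous.intervalIntegrable (by fun_prop) _ _

/-- the nonlinear term has zero mean -/
lemma aux_mean_zero (a f h : ℝ → ℝ) (ha : Continuous a) (hev : ∀ x, a (-x) = a x)
    (hf : Continuous f) (hh : Continuous h) :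
    ∫ x in (0:ℝ)..(2*π), (f x * conv1 a h x - h x * conv1 a f x) = 0 := by
  have c1 := aux_conv_cont a f ha hf
  have c2 := aux_conv_cont a h ha hh
  rw [intervalIntegral.integral_sub
    (Continuous.intervalIntegrable (by fun_prop) _ _)
    (Continuous.intervalIntegrable (by fun_prop) _ _), sub_eq_zero]
  have e1 : ∀ x, f x * conv1 a h x = ∫ y in (0:ℝ)..(2*π), f x * (a (x - y) * h y) := by
    intro x; rw [conv1, intervalIntegral.integral_const_mul]
  have e2 : ∀ x, h x * conv1 a f x = ∫ y in (0:ℝ)..(2*π), h x * (a (x - y) * f y) := by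
    intro x; rw [conv1, intervalIntegral.integral_const_mul]
  simp only [e1, e2]
  rw [intervalIntegral_intervalIntegral_swap]
  · congr 1; ext y; congr 1; ext x
    rw [← hev, neg_sub]; ring
  · refine IntegrableOn.mono_set ?_ (Set.prod_mono Set.uIoc_subset_uIcc Set.uIoc_subset_uIcc)
    apply ContinuousOn.integrableOn_compact (isCompact_uIcc.prod isCompact_uIcc)
    apply Continuous.continuousOn
    simp only [Function.uncurry_def]
    fun_prop

lemma aux_cubic (v Q S P : ℝ) (hv : 0 < v) (hQ : 0 < Q) (hS : 0 ≤ S)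
    (h : v ^ 2 * P ^ 2 + S ^ 2 ≤ v ^ 2 * Q ^ 2) : 2 * (S * P ^ 2) ≤ v * Q ^ 3 := by
  have h1 : 2 * S * (v ^ 2 * P ^ 2) ≤ 2 * S * (v ^ 2 * Q ^ 2 - S ^ 2) := by
    apply mul_le_mul_of_nonneg_left _ (by positivity); linarith
  have h2 : 2 * S * (v ^ 2 * Q ^ 2 - S ^ 2) ≤ (v * Q) ^ 3 := by
    have hm : 0 < v * Q := by positivity
    nlinarith [mul_nonneg hS (sq_nonneg (5 * S - 3 * (v * Q))), mul_nonneg hm.le (sq_nonneg (5 * S - 3 * (v * Q))), mul_nonneg hm.le (sq_nonneg S)]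
  have : v ^ 2 * (2 * (S * P ^ 2)) ≤ v ^ 2 * (v * Q ^ 3) := by nlinarith
  exact le_of_mul_le_mul_left this (by positivity)

lemma aux_alg1 (v r J : ℝ) : |J ^ 2 - v ^ 2 * r ^ 2| ≤ v ^ 2 * r ^ 2 + J ^ 2 := by
  rw [abs_le]
  constructor <;> nlinarith [sq_nonneg J, sq_nonneg (v * r)]

lemma aux_alg2 (v r J : ℝ) : |v * r * (J - v * r)| ≤ 2 * (v ^ 2 * r ^ 2 + J ^ 2) := by
  rw [abs_le]
  constructor <;> nlinarith [sq_nonneg J, sq_nonneg (v * r), sq_nonneg (J - v * r),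
    sq_nonneg (J + v * r)]

set_option maxHeartbeats 1600000 in
lemma aux_static (Ca θ : ℝ) (hCa : 0 < Ca) (hθ : 0 ≤ θ)
    (g : ℝ → ℝ) (hg : Continuous g) (hgp : Function.Periodic g (2*π))
    (v : ℝ) (hv : 0 < v) (r J W r' J' W' Wt : ℝ → ℝ)
    (hr : ∀ x, HasDerivAt r (r' x) x) (hJ : ∀ x, HasDerivAt J (J' x) x)
    (hW : ∀ x, HasDerivAt W (W' x) x)
    (cr : Continuous r') (cJ : Continuous J') (cW : Continuous W') (cWt : Continuous Wt)
    (pr : Function.Periodic r (2*π)) (pJ : Function.Periodic J (2*π))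
    (pW : Function.Periodic W (2*π))
    (A B D : ℝ) (hA : ∀ x, |W' x| ≤ A) (hB : ∀ x, |Wt x| ≤ B) (hD : ∀ x, |1 - W x| ≤ D)
    (mr : (∫ x in (0:ℝ)..(2*π), r x) = 1) (mJ : (∫ x in (0:ℝ)..(2*π), J x) = v)
    (Q : ℝ) (hQ : 0 < Q) (hQs : 8 * θ * nrm g * Q < Ca)
    (hE : v ^ 2 * nrm r ^ 2 + nrm J ^ 2 ≤ v ^ 2 * Q ^ 2)
    (N : ℝ → ℝ) (hN : ∀ x, N x = r x * conv1 (fun x => Ca + θ * g x) J x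
      - J x * conv1 (fun x => Ca + θ * g x) r x) :
    ∫ x in (0:ℝ)..(2*π),
      ((N x - v ^ 2 * (W' x * r x + W x * r' x) + v * J' x) * (J x - v * W x * r x)
        + (J x - v * r x) * (N x - v ^ 2 * (W' x * r x + W x * r' x)
            - v * (Wt x * r x - W x * J' x)))
      ≤ - Ca * ip (fun x => J x - v * r x) (fun x => J x - v * W x * r x)
        + (2 * v ^ 2 * Q ^ 2 * (v * A + B) + v ^ 2 * θ * nrm g * Q ^ 3 * D) := by
  have cr0 : Continuous r := continuous_iff_continuousAt.2 fun x => (hr x).continuousAt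
  have cJ0 : Continuous J := continuous_iff_continuousAt.2 fun x => (hJ x).continuousAt
  have cW0 : Continuous W := continuous_iff_continuousAt.2 fun x => (hW x).continuousAt
  set u : ℝ → ℝ := fun x => J x - v * r x with hu
  have cu : Continuous u := by fun_prop
  set K := nrm g with hK
  have hK0 : 0 ≤ K := aux_nrm_nonneg _
  set U := nrm u with hU
  have hU0 : 0 ≤ U := aux_nrm_nonneg _
  set P := nrm r with hP
  have hP0 : 0 ≤ P := aux_nrm_nonneg _
  set S := nrm J with hS
  have hS0 : 0 ≤ S := aux_nrm_nonneg _
  have hA0 : 0 ≤ A := (abs_nonneg _).trans (hA 0)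
  have hB0 : 0 ≤ B := (abs_nonneg _).trans (hB 0)
  have hD0 : 0 ≤ D := (abs_nonneg _).trans (hD 0)
  have bu := aux_conv_bound g u hg hgp cu
  have br := aux_conv_bound g r hg hgp cr0
  have bJ := aux_conv_bound g J hg hgp cJ0
  have hNx : ∀ x, N x = - Ca * u x + θ * (r x * conv1 g J x - J x * conv1 g r x) := by
    intro x
    rw [hN, aux_conv_affine Ca θ g J hg cJ0, aux_conv_affine Ca θ g r hg cr0, mr, mJ, hu]
    ring
  have cGJ := aux_conv_cont g J hg cJ0
  have cGr := aux_conv_cont g r hg cr0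
  have hGu : ∀ x, conv1 g u x = conv1 g J x - v * conv1 g r x :=
    aux_conv_sub g J r v hg cJ0 cr0
  have cN : Continuous N := by
    have : N = fun x => - Ca * u x + θ * (r x * conv1 g J x - J x * conv1 g r x) := funext hNx
    rw [this]; fun_prop
  -- total derivative
  set F : ℝ → ℝ := fun x => (J x - v * W x * r x) ^ 2 / 2 + W x * u x ^ 2 / 2 with hF
  set F' : ℝ → ℝ := fun x => (J x - v * W x * r x) * (J' x - v * (W' x * r x + W x * r' x))
    + (W' x * u x ^ 2 / 2 + W x * u x * (J' x - v * r' x)) with hF'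
  have dF : ∀ x, HasDerivAt F (F' x) x := by
    intro x
    have h1 := ((hJ x).sub (((hW x).const_mul v).mul (hr x))).pow 2
    have h2 := (hJ x).sub ((hr x).const_mul v)
    have h3 := ((hW x).mul (h2.pow 2))
    have := (h1.div_const 2).add (h3.div_const 2)
    refine HasDerivAt.congr_deriv (f := F) this ?_
    simp only [hF', hu, Nat.cast_ofNat, Pi.mul_apply, Pi.sub_apply, Pi.pow_apply]; ring
  have cF' : Continuous F' := by fun_prop
  have intF : ∫ x in (0:ℝ)..(2*π), F' x = 0 := by
    rw [intervalIntegral.integral_eq_sub_of_hasDerivAt (fun x _ => dF x)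
      (cF'.intervalIntegrable _ _)]
    have e1 := pr 0
    have e2 := pJ 0
    have e3 := pW 0
    simp only [zero_add] at e1 e2 e3
    simp [hF, hu, e1, e2, e3]
  -- pointwise bound
  have pt : ∀ x, (N x - v ^ 2 * (W' x * r x + W x * r' x) + v * J' x) * (J x - v * W x * r x)
        + (J x - v * r x) * (N x - v ^ 2 * (W' x * r x + W x * r' x)
            - v * (Wt x * r x - W x * J' x))
      ≤ - Ca * (u x * (J x - v * W x * r x)) + v * F' x
        + (- Ca + 2 * θ * (K * P)) * u x ^ 2 + 2 * θ * (K * U) * (|r x| * |u x|)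
        + θ * v * D * (K * S) * r x ^ 2 + θ * v * D * (K * P) * (|J x| * |r x|)
        + (v / 2 * A + 2 * B) * (v ^ 2 * r x ^ 2 + J x ^ 2) := by
    intro x
    have id1 : (N x - v ^ 2 * (W' x * r x + W x * r' x) + v * J' x) * (J x - v * W x * r x)
        + (J x - v * r x) * (N x - v ^ 2 * (W' x * r x + W x * r' x)
            - v * (Wt x * r x - W x * J' x))
        = - Ca * (u x * (J x - v * W x * r x)) + v * F' x - Ca * u x ^ 2
          + 2 * θ * ((r x * u x) * conv1 g u x) - 2 * θ * (u x ^ 2 * conv1 g r x)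
          + θ * v * ((1 - W x) * (r x ^ 2 * conv1 g J x))
          - θ * v * ((1 - W x) * ((J x * r x) * conv1 g r x))
          - v / 2 * (W' x * (J x ^ 2 - v ^ 2 * r x ^ 2))
          - Wt x * (v * r x * (J x - v * r x)) := by
      rw [hNx, hGu]
      simp only [hF', hu]
      ring
    rw [id1]
    have t1 : (r x * u x) * conv1 g u x ≤ (|r x| * |u x|) * (K * U) := by
      refine (le_abs_self _).trans ?_
      rw [abs_mul, abs_mul]
      exact mul_le_mul_of_nonneg_left (bu x) (by positivity)
    have t2 : -(u x ^ 2 * conv1 g r x) ≤ u x ^ 2 * (K * P) := by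
      refine (neg_le_abs _).trans ?_
      rw [abs_mul, abs_of_nonneg (sq_nonneg (u x))]
      exact mul_le_mul_of_nonneg_left (br x) (by positivity)
    have t3 : (1 - W x) * (r x ^ 2 * conv1 g J x) ≤ D * (r x ^ 2 * (K * S)) := by
      refine (le_abs_self _).trans ?_
      rw [abs_mul, abs_mul, abs_of_nonneg (sq_nonneg (r x))]
      exact mul_le_mul (hD x) (mul_le_mul_of_nonneg_left (bJ x) (by positivity))
        (by positivity) hD0
    have t4 : -((1 - W x) * ((J x * r x) * conv1 g r x)) ≤ D * ((|J x| * |r x|) * (K * P)) := by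
      refine (neg_le_abs _).trans ?_
      rw [abs_mul, abs_mul, abs_mul]
      exact mul_le_mul (hD x) (mul_le_mul_of_nonneg_left (br x) (by positivity))
        (by positivity) hD0
    have t5 : -(W' x * (J x ^ 2 - v ^ 2 * r x ^ 2)) ≤ A * (v ^ 2 * r x ^ 2 + J x ^ 2) := by
      refine (neg_le_abs _).trans ?_
      rw [abs_mul]
      exact mul_le_mul (hA x) (aux_alg1 _ _ _) (abs_nonneg _) hA0
    have t6 : -(Wt x * (v * r x * (J x - v * r x))) ≤ B * (2 * (v ^ 2 * r x ^ 2 + J x ^ 2)) := by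
      refine (neg_le_abs _).trans ?_
      rw [abs_mul]
      exact mul_le_mul (hB x) (aux_alg2 _ _ _) (abs_nonneg _) hB0
    have s1 := mul_le_mul_of_nonneg_left t1 (show 0 ≤ 2 * θ by positivity)
    have s2 := mul_le_mul_of_nonneg_left t2 (show 0 ≤ 2 * θ by positivity)
    have s3 := mul_le_mul_of_nonneg_left t3 (show 0 ≤ θ * v by positivity)
    have s4 := mul_le_mul_of_nonneg_left t4 (show 0 ≤ θ * v by positivity)
    have s5 := mul_le_mul_of_nonneg_left t5 (show 0 ≤ v / 2 by positivity)
    linarith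
  have mono := intervalIntegral.integral_mono_on aux_two_pi_nonneg
    (Continuous.intervalIntegrable (by fun_prop) _ _)
    (Continuous.intervalIntegrable (by fun_prop) _ _) (μ := volume) (fun x _ => pt x)
  refine mono.trans ?_
  have split : ∫ x in (0:ℝ)..(2*π), (- Ca * (u x * (J x - v * W x * r x)) + v * F' x
        + (- Ca + 2 * θ * (K * P)) * u x ^ 2 + 2 * θ * (K * U) * (|r x| * |u x|)
        + θ * v * D * (K * S) * r x ^ 2 + θ * v * D * (K * P) * (|J x| * |r x|)
        + (v / 2 * A + 2 * B) * (v ^ 2 * r x ^ 2 + J x ^ 2))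
      = - Ca * ip u (fun x => J x - v * W x * r x) + v * (∫ x in (0:ℝ)..(2*π), F' x)
        + (- Ca + 2 * θ * (K * P)) * U ^ 2
        + 2 * θ * (K * U) * (∫ x in (0:ℝ)..(2*π), |r x| * |u x|)
        + θ * v * D * (K * S) * P ^ 2
        + θ * v * D * (K * P) * (∫ x in (0:ℝ)..(2*π), |J x| * |r x|)
        + (v / 2 * A + 2 * B) * (v ^ 2 * P ^ 2 + S ^ 2) := by
    have e7 : v ^ 2 * P ^ 2 + S ^ 2 = ∫ x in (0:ℝ)..(2*π), (v ^ 2 * r x ^ 2 + J x ^ 2) := by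
      rw [hP, hS, aux_nrm_sq, aux_nrm_sq, ← intervalIntegral.integral_const_mul,
        ← intervalIntegral.integral_add]
      all_goals exact Continuous.intervalIntegrable (by fun_prop) _ _
    have e5 : U ^ 2 = ∫ x in (0:ℝ)..(2*π), u x ^ 2 := aux_nrm_sq u
    have e6 : P ^ 2 = ∫ x in (0:ℝ)..(2*π), r x ^ 2 := aux_nrm_sq r
    rw [e7, e5, e6, ip]
    simp only [← intervalIntegral.integral_const_mul]
    iterate 6 rw [← intervalIntegral.integral_add]
    all_goals exact Continuous.intervalIntegrable (by fun_prop) _ _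
  rw [split, intF]
  have c1 := aux_cs_abs r u cr0 cu
  have c2 := aux_cs_abs J r cJ0 cr0
  rw [← hU, ← hP] at c1
  rw [← hS, ← hP] at c2
  have hPQ : P ≤ Q := by
    have : v ^ 2 * P ^ 2 ≤ v ^ 2 * Q ^ 2 := by nlinarith [sq_nonneg S]
    have := le_of_mul_le_mul_left this (by positivity)
    exact abs_le_of_sq_le_sq' this hQ.le |>.2
  have d1 := mul_le_mul_of_nonneg_left c1 (show 0 ≤ 2 * θ * (K * U) by positivity)
  have d2 := mul_le_mul_of_nonneg_left c2 (show 0 ≤ θ * v * D * (K * P) by positivity)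
  have d3 := mul_le_mul_of_nonneg_left hE (show 0 ≤ v / 2 * A + 2 * B by positivity)
  have d4 := mul_le_mul_of_nonneg_left (aux_cubic v Q S P hv hQ hS0 hE)
    (show 0 ≤ θ * v * D * K by positivity)
  have d5 : 4 * θ * K * P * U ^ 2 ≤ Ca * U ^ 2 := by
    apply mul_le_mul_of_nonneg_right _ (sq_nonneg U)
    have : 4 * θ * K * P ≤ 4 * θ * K * Q := mul_le_mul_of_nonneg_left hPQ (by positivity)
    have : 0 ≤ θ * K * Q := by positivity
    nlinarith
  have d6 : 0 ≤ v ^ 3 * Q ^ 2 * A := by positivity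
  nlinarith

lemma aux_partials (T : ℝ) (hT : 0 < T) (F : ℝ → ℝ → ℝ)
    (hF : ContDiffOn ℝ (⊤ : ℕ∞) (fun p : ℝ × ℝ => F p.1 p.2) (Set.univ ×ˢ Set.Icc (0:ℝ) T)) :
    ∃ Fx Ft : ℝ → ℝ → ℝ,
      ContinuousOn (fun p : ℝ × ℝ => Fx p.1 p.2) (Set.univ ×ˢ Set.Icc (0:ℝ) T) ∧
      ContinuousOn (fun p : ℝ × ℝ => Ft p.1 p.2) (Set.univ ×ˢ Set.Icc (0:ℝ) T) ∧
      (∀ x, ∀ t ∈ Set.Icc (0:ℝ) T, HasDerivAt (fun y => F y t) (Fx x t) x) ∧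
      (∀ x, ∀ t ∈ Set.Icc (0:ℝ) T,
        HasDerivWithinAt (fun s => F x s) (Ft x t) (Set.Icc (0:ℝ) T) t) := by
  set S : Set (ℝ × ℝ) := Set.univ ×ˢ Set.Icc (0:ℝ) T with hS
  have hu : UniqueDiffOn ℝ S := uniqueDiffOn_univ.prod (uniqueDiffOn_Icc hT)
  have hc : ContinuousOn (fderivWithin ℝ (fun p : ℝ × ℝ => F p.1 p.2) S) S :=
    hF.continuousOn_fderivWithin hu (by simp)
  have hd : ∀ p ∈ S, HasFDerivWithinAt (fun p : ℝ × ℝ => F p.1 p.2)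
      (fderivWithin ℝ (fun p : ℝ × ℝ => F p.1 p.2) S p) S p := fun p hp =>
    ((hF.differentiableOn (by simp)) p hp).hasFDerivWithinAt
  refine ⟨fun x t => fderivWithin ℝ (fun p : ℝ × ℝ => F p.1 p.2) S (x, t) (1, 0),
    fun x t => fderivWithin ℝ (fun p : ℝ × ℝ => F p.1 p.2) S (x, t) (0, 1), ?_, ?_, ?_, ?_⟩
  · exact hc.clm_apply continuousOn_const
  · exact hc.clm_apply continuousOn_const
  · intro x t ht
    have h1 : HasDerivAt (fun y : ℝ => (y, t)) ((1:ℝ), (0:ℝ)) x :=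
      (hasDerivAt_id x).prodMk (hasDerivAt_const x t)
    have hm : ∀ y : ℝ, (y, t) ∈ S := fun y => ⟨Set.mem_univ _, ht⟩
    exact HasFDerivWithinAt.comp_hasDerivAt x (hd (x, t) (hm x)) h1
      (Filter.Eventually.of_forall hm)
  · intro x t ht
    have h1 : HasDerivWithinAt (fun s : ℝ => (x, s)) ((0:ℝ), (1:ℝ)) (Set.Icc (0:ℝ) T) t :=
      (hasDerivWithinAt_const t _ x).prodMk (hasDerivWithinAt_id t _)
    exact (hd (x, t) ⟨Set.mem_univ _, ht⟩).comp_hasDerivWithinAt t h1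
      (fun s hs => ⟨Set.mem_univ _, hs⟩)

/-- slices are continuous -/
lemma aux_slice (T : ℝ) (F : ℝ → ℝ → ℝ)
    (hF : ContinuousOn (fun p : ℝ × ℝ => F p.1 p.2) (Set.univ ×ˢ Set.Icc (0:ℝ) T))
    (t : ℝ) (ht : t ∈ Set.Icc (0:ℝ) T) : Continuous (fun x => F x t) := by
  have : Continuous (fun x : ℝ => (x, t)) := by fun_prop
  exact hF.comp_continuous this (fun x => ⟨Set.mem_univ _, ht⟩)

/-- extension by projection is continuous -/
lemma aux_ext (T : ℝ) (hT : 0 < T) (F : ℝ → ℝ → ℝ)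
    (hF : ContinuousOn (fun p : ℝ × ℝ => F p.1 p.2) (Set.univ ×ˢ Set.Icc (0:ℝ) T)) :
    Continuous (fun p : ℝ × ℝ => F p.2 (Set.projIcc 0 T hT.le p.1 : ℝ)) := by
  have h1 : Continuous (fun p : ℝ × ℝ => (p.2, (Set.projIcc 0 T hT.le p.1 : ℝ))) := by
    have := (continuous_projIcc (h := hT.le)).comp (continuous_fst (X := ℝ) (Y := ℝ))
    exact continuous_snd.prodMk (continuous_subtype_val.comp this)
  exact hF.comp_continuous h1 (fun p => ⟨Set.mem_univ _, Subtype.coe_prop _⟩)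

lemma aux_int_cont (T : ℝ) (hT : 0 < T) (F : ℝ → ℝ → ℝ)
    (hF : ContinuousOn (fun p : ℝ × ℝ => F p.1 p.2) (Set.univ ×ˢ Set.Icc (0:ℝ) T)) :
    ContinuousOn (fun t => ∫ x in (0:ℝ)..(2*π), F x t) (Set.Icc 0 T) := by
  have h1 : Continuous fun t => ∫ x in (0:ℝ)..(2*π), F x (Set.projIcc 0 T hT.le t : ℝ) :=
    intervalIntegral.continuous_parametric_intervalIntegral_of_continuous'
      (f := fun t x => F x (Set.projIcc 0 T hT.le t : ℝ)) (aux_ext T hT F hF) _ _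
  refine h1.continuousOn.congr fun t ht => ?_
  simp only [Set.projIcc_of_mem hT.le ht]

lemma aux_int_deriv (T : ℝ) (F Ft : ℝ → ℝ → ℝ)
    (hF : ContinuousOn (fun p : ℝ × ℝ => F p.1 p.2) (Set.univ ×ˢ Set.Icc (0:ℝ) T))
    (hFt : ContinuousOn (fun p : ℝ × ℝ => Ft p.1 p.2) (Set.univ ×ˢ Set.Icc (0:ℝ) T))
    (hd : ∀ x, ∀ t ∈ Set.Icc (0:ℝ) T,
        HasDerivWithinAt (fun s => F x s) (Ft x t) (Set.Icc (0:ℝ) T) t)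
    (t : ℝ) (ht : t ∈ Set.Ioo 0 T) :
    HasDerivAt (fun t => ∫ x in (0:ℝ)..(2*π), F x t) (∫ x in (0:ℝ)..(2*π), Ft x t) t := by
  obtain ⟨C, hC⟩ := ((isCompact_uIcc (a := (0:ℝ)) (b := 2*π)).prod
    (isCompact_Icc (a := (0:ℝ)) (b := T))).exists_bound_of_continuousOn
      (hFt.mono (Set.prod_mono (Set.subset_univ _) subset_rfl))
  have hn : Set.Ioo 0 T ∈ nhds t := Ioo_mem_nhds ht.1 ht.2
  refine (intervalIntegral.hasDerivAt_integral_of_dominated_loc_of_deriv_le (μ := volume)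
    (F := fun t x => F x t) (F' := fun t x => Ft x t) (bound := fun _ => C) hn ?_ ?_ ?_ ?_ ?_ ?_).2
  · filter_upwards [hn] with s hs
    exact (aux_slice T F hF s (Set.Ioo_subset_Icc_self hs)).aestronglyMeasurable
  · exact (aux_slice T F hF t (Set.Ioo_subset_Icc_self ht)).intervalIntegrable _ _
  · exact (aux_slice T Ft hFt t (Set.Ioo_subset_Icc_self ht)).aestronglyMeasurable
  · refine Filter.Eventually.of_forall fun x hx s hs => ?_
    exact hC (x, s) ⟨Set.uIoc_subset_uIcc hx, Set.Ioo_subset_Icc_self hs⟩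
  · exact intervalIntegrable_const
  · refine Filter.Eventually.of_forall fun x _ s hs => ?_
    exact (hd x s (Set.Ioo_subset_Icc_self hs)).hasDerivAt (Icc_mem_nhds hs.1 hs.2)

lemma aux_const (T : ℝ) (M : ℝ → ℝ) (hc : ContinuousOn M (Set.Icc 0 T))
    (hd : ∀ t ∈ Set.Ioo 0 T, HasDerivAt M 0 t) : ∀ t ∈ Set.Icc 0 T, M t = M 0 := by
  intro t ht
  rcases ht.1.eq_or_lt with h | h
  · rw [← h]
  · obtain ⟨c, hc1, hc2⟩ := exists_hasDerivAt_eq_slope M (fun _ => 0) h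
      (hc.mono (Set.Icc_subset_Icc_right ht.2))
      (fun s hs => hd s ⟨hs.1, hs.2.trans_le ht.2⟩)
    have : t - 0 ≠ 0 := by linarith
    field_simp at hc2
    linarith

lemma aux_int_periodic_deriv (f f' : ℝ → ℝ) (hf : ∀ x, HasDerivAt f (f' x) x)
    (hc : Continuous f') (hp : Function.Periodic f (2*π)) :
    ∫ x in (0:ℝ)..(2*π), f' x = 0 := by
  rw [intervalIntegral.integral_eq_sub_of_hasDerivAt (fun x _ => hf x) (hc.intervalIntegrable _ _)]
  have := hp 0
  rw [zero_add] at this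
  rw [this, sub_self]

lemma aux_sup_eq (f : ℝ → ℝ) (hp : Function.Periodic f (2*π)) :
    supNorm f = sSup ((fun x => |f x|) '' Set.Icc 0 (2*π)) := by
  rw [supNorm, iSup]
  congr 1
  ext y
  constructor
  · rintro ⟨x, rfl⟩
    obtain ⟨z, hz, h⟩ := hp.exists_mem_Ico₀ (by positivity) x
    exact ⟨z, Set.Ico_subset_Icc_self hz, by simp only [h]⟩
  · rintro ⟨x, _, rfl⟩
    exact ⟨x, rfl⟩

lemma aux_sup_le (f : ℝ → ℝ) (hc : Continuous f) (hp : Function.Periodic f (2*π)) (x : ℝ) :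
    |f x| ≤ supNorm f := by
  rw [aux_sup_eq f hp]
  obtain ⟨z, hz, h⟩ := hp.exists_mem_Ico₀ (by positivity) x
  rw [h]
  exact le_csSup (isCompact_Icc.image hc.abs).bddAbove ⟨z, Set.Ico_subset_Icc_self hz, rfl⟩

lemma aux_sup_cont (T : ℝ) (hT : 0 < T) (F : ℝ → ℝ → ℝ)
    (hF : ContinuousOn (fun p : ℝ × ℝ => F p.1 p.2) (Set.univ ×ˢ Set.Icc (0:ℝ) T))
    (hp : ∀ t ∈ Set.Icc (0:ℝ) T, Function.Periodic (fun x => F x t) (2*π)) :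
    ContinuousOn (fun t => supNorm (fun x => F x t)) (Set.Icc 0 T) := by
  have h1 : Continuous fun t =>
      sSup ((fun x => |F x (Set.projIcc 0 T hT.le t : ℝ)|) '' Set.Icc 0 (2*π)) :=
    (isCompact_Icc).continuous_sSup
      (f := fun t x => |F x (Set.projIcc 0 T hT.le t : ℝ)|) (aux_ext T hT F hF).abs
  refine h1.continuousOn.congr fun t ht => ?_
  simp only [Set.projIcc_of_mem hT.le ht]
  exact aux_sup_eq _ (hp t ht)

/-- Step IIa in the proof of Proposition `local_result_w`: decay of
`R(t) = ⟨j − v̄ρ, j − v̄wρ⟩`. -/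
theorem stmt6 (Ca θ : ℝ) (hCa : 0 < Ca) (hθ : 0 ≤ θ)
    (g : ℝ → ℝ) (hg_cont : Continuous g) (hg_per : Function.Periodic g (2*π))
    (a : ℝ → ℝ) (ha : a = fun x => Ca + θ * g x)
    (ha_even : ∀ x, a (-x) = a x) (ha_pos : ∀ x, 0 < a x)
    (vbar : ℝ) (hvbar : 0 < vbar) (T : ℝ) (hT : 0 < T)
    (w : ℝ → ℝ → ℝ)
    (hw_per : ∀ t ∈ Set.Icc (0:ℝ) T, Function.Periodic (fun x => w x t) (2*π))
    (hw_smooth : ContDiffOn ℝ (⊤ : ℕ∞) (fun p : ℝ × ℝ => w p.1 p.2) (Set.univ ×ˢ Set.Icc (0:ℝ) T))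
    (wmin wmax : ℝ) (hwmin : 0 < wmin)
    (hw_bounds : ∀ (x : ℝ), ∀ t ∈ Set.Icc (0:ℝ) T, wmin ≤ w x t ∧ w x t ≤ wmax)
    (ρ j : ℝ → ℝ → ℝ) (hsol : IsWeightedSol a vbar w ρ j (Set.Icc 0 T))
    (hmass_rho : (∫ x in (0:ℝ)..(2*π), ρ x 0) = 1)
    (hmass_j : (∫ x in (0:ℝ)..(2*π), j x 0) = vbar)
    (Q : ℝ) (hQ : 0 < Q) (hQsmall : 8 * θ * nrm g * Q < Ca)
    (henergy : ∀ t ∈ Set.Icc (0:ℝ) T,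
      vbar ^ 2 * nrm (fun x => ρ x t) ^ 2 + nrm (fun x => j x t) ^ 2 ≤ vbar ^ 2 * Q ^ 2)
    (betaT : ℝ → ℝ)
    (hbetaT : ∀ s, betaT s =
      2 * vbar ^ 2 * Q ^ 2 * (vbar * supNorm (fun x => deriv (fun y => w y s) x)
          + supNorm (fun x => derivWithin (fun τ => w x τ) (Set.Icc (0:ℝ) T) s))
        + vbar ^ 2 * θ * nrm g * Q ^ 3 * supNorm (fun x => 1 - w x s))
    (R : ℝ → ℝ)
    (hR : ∀ t, R t = ip (fun x => j x t - vbar * ρ x t)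
        (fun x => j x t - vbar * w x t * ρ x t)) :
    ∀ t ∈ Set.Icc (0:ℝ) T,
      R t ≤ R 0 * Real.exp (-Ca * t)
        + Real.exp (-Ca * t) * ∫ s in (0:ℝ)..t, Real.exp (Ca * s) * betaT s := by
  have cρ0 := hsol.smooth_rho.continuousOn
  have cj0 := hsol.smooth_j.continuousOn
  have cw0 := hw_smooth.continuousOn
  obtain ⟨ρx, ρt, cρx, cρt, dρx, dρt⟩ := aux_partials T hT ρ hsol.smooth_rho
  obtain ⟨jx, jt, cjx, cjt, djx, djt⟩ := aux_partials T hT j hsol.smooth_j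
  obtain ⟨wx, wt, cwx, cwt, dwx, dwt⟩ := aux_partials T hT w hw_smooth
  have ca : Continuous a := by rw [ha]; fun_prop
  have hud : UniqueDiffOn ℝ (Set.Icc (0:ℝ) T) := uniqueDiffOn_Icc hT
  have eρt : ∀ x, ∀ t ∈ Set.Icc (0:ℝ) T, ρt x t = - jx x t := by
    intro x t ht
    rw [← (dρt x t ht).derivWithin (hud t ht), hsol.pde_rho x t ht, (djx x t ht).deriv]
  have ejt : ∀ x, ∀ t ∈ Set.Icc (0:ℝ) T, jt x t =
      (ρ x t * conv1 a (fun y => j y t) x - j x t * conv1 a (fun y => ρ y t) x)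
        - vbar ^ 2 * (wx x t * ρ x t + w x t * ρx x t) := by
    intro x t ht
    rw [← (djt x t ht).derivWithin (hud t ht), hsol.pde_j x t ht,
      ((dwx x t ht).fun_mul (dρx x t ht)).deriv]
  -- masses
  have mass_rho : ∀ t ∈ Set.Icc (0:ℝ) T, (∫ x in (0:ℝ)..(2*π), ρ x t) = 1 := by
    intro t ht
    rw [← hmass_rho]
    refine aux_const T (fun t => ∫ x in (0:ℝ)..(2*π), ρ x t) (aux_int_cont T hT ρ cρ0) ?_ t ht
    intro s hs
    have hs' := Set.Ioo_subset_Icc_self hs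
    refine (aux_int_deriv T ρ ρt cρ0 cρt dρt s hs).congr_deriv ?_
    simp only [eρt _ s hs', intervalIntegral.integral_neg]
    rw [aux_int_periodic_deriv (fun x => j x s) (fun x => jx x s) (fun x => djx x s hs')
      (aux_slice T jx cjx s hs') (hsol.periodic_j s hs'), neg_zero]
  have mass_j : ∀ t ∈ Set.Icc (0:ℝ) T, (∫ x in (0:ℝ)..(2*π), j x t) = vbar := by
    intro t ht
    rw [← hmass_j]
    refine aux_const T (fun t => ∫ x in (0:ℝ)..(2*π), j x t) (aux_int_cont T hT j cj0) ?_ t ht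
    intro s hs
    have hs' := Set.Ioo_subset_Icc_self hs
    have k1 := aux_slice T ρ cρ0 s hs'
    have k2 := aux_slice T j cj0 s hs'
    have k3 := aux_slice T w cw0 s hs'
    have k4 := aux_slice T ρx cρx s hs'
    have k5 := aux_slice T wx cwx s hs'
    have k6 := aux_conv_cont a _ ca k1
    have k7 := aux_conv_cont a _ ca k2
    refine (aux_int_deriv T j jt cj0 cjt djt s hs).congr_deriv ?_
    simp only [ejt _ s hs']
    rw [intervalIntegral.integral_sub
      (Continuous.intervalIntegrable (by fun_prop) _ _)
      (Continuous.intervalIntegrable (by fun_prop) _ _),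
      aux_mean_zero a (fun x => ρ x s) (fun x => j x s) ca ha_even k1 k2,
      intervalIntegral.integral_const_mul,
      aux_int_periodic_deriv (fun x => w x s * ρ x s) (fun x => wx x s * ρ x s + w x s * ρx x s)
        (fun x => (dwx x s hs').fun_mul (dρx x s hs')) (by fun_prop)
        ((hw_per s hs').mul (hsol.periodic_rho s hs'))]
    ring
  -- sup norms
  have pwx : ∀ t ∈ Set.Icc (0:ℝ) T, Function.Periodic (fun x => wx x t) (2*π) := by
    intro t ht x
    have h1 := (dwx (x + 2*π) t ht).comp_add_const x (2*π)
    have h2 : (fun y => w (y + 2*π) t) = fun y => w y t := funext (hw_per t ht)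
    rw [h2] at h1
    exact h1.unique (dwx x t ht)
  have pwt : ∀ t ∈ Set.Icc (0:ℝ) T, Function.Periodic (fun x => wt x t) (2*π) := by
    intro t ht x
    have h1 := (dwt (x + 2*π) t ht).congr (fun s hs => (hw_per s hs x).symm) (hw_per t ht x).symm
    exact (hud t ht).eq_deriv _ h1 (dwt x t ht)
  have c1w : ContinuousOn (fun p : ℝ × ℝ => 1 - w p.1 p.2) (Set.univ ×ˢ Set.Icc (0:ℝ) T) :=
    continuousOn_const.sub cw0
  have p1w : ∀ t ∈ Set.Icc (0:ℝ) T, Function.Periodic (fun x => 1 - w x t) (2*π) := by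
    intro t ht x
    have := hw_per t ht x
    simp only at this ⊢
    rw [this]
  have ebeta : ∀ s ∈ Set.Icc (0:ℝ) T, betaT s =
      2 * vbar ^ 2 * Q ^ 2 * (vbar * supNorm (fun x => wx x s) + supNorm (fun x => wt x s))
        + vbar ^ 2 * θ * nrm g * Q ^ 3 * supNorm (fun x => 1 - w x s) := by
    intro s hs
    rw [hbetaT]
    have e1 : (fun x => deriv (fun y => w y s) x) = fun x => wx x s :=
      funext fun x => (dwx x s hs).deriv
    have e2 : (fun x => derivWithin (fun τ => w x τ) (Set.Icc (0:ℝ) T) s) = fun x => wt x s :=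
      funext fun x => (dwt x s hs).derivWithin (hud s hs)
    rw [e1, e2]
  have cbeta : ContinuousOn betaT (Set.Icc 0 T) := by
    have q1 := aux_sup_cont T hT wx cwx pwx
    have q2 := aux_sup_cont T hT wt cwt pwt
    have q3 := aux_sup_cont T hT (fun x s => 1 - w x s) c1w p1w
    exact ContinuousOn.congr (by fun_prop) ebeta
  -- derivative of R
  have eR : R = fun t => ∫ x in (0:ℝ)..(2*π),
      (j x t - vbar * ρ x t) * (j x t - vbar * w x t * ρ x t) := funext hR
  have cR : ContinuousOn R (Set.Icc 0 T) := by
    rw [eR]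
    exact aux_int_cont T hT
      (fun x t => (j x t - vbar * ρ x t) * (j x t - vbar * w x t * ρ x t)) (by fun_prop)
  have dR : ∀ t ∈ Set.Ioo 0 T, ∃ R', HasDerivAt R R' t ∧ R' ≤ - Ca * R t + betaT t := by
    intro t ht
    have ht' := Set.Ioo_subset_Icc_self ht
    refine ⟨∫ x in (0:ℝ)..(2*π), ((jt x t - vbar * ρt x t) * (j x t - vbar * w x t * ρ x t)
      + (j x t - vbar * ρ x t) *
        (jt x t - (vbar * wt x t * ρ x t + vbar * w x t * ρt x t))), ?_, ?_⟩
    · rw [eR]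
      refine aux_int_deriv T
        (fun x t => (j x t - vbar * ρ x t) * (j x t - vbar * w x t * ρ x t))
        (fun x t => (jt x t - vbar * ρt x t) * (j x t - vbar * w x t * ρ x t)
          + (j x t - vbar * ρ x t) *
            (jt x t - (vbar * wt x t * ρ x t + vbar * w x t * ρt x t)))
        (by fun_prop) (by fun_prop) ?_ t ht
      intro x s hs
      exact ((djt x s hs).fun_sub ((dρt x s hs).const_mul vbar)).fun_mul
        ((djt x s hs).fun_sub (((dwt x s hs).const_mul vbar).fun_mul (dρt x s hs)))
    · rw [hR, ebeta t ht']
      refine le_trans (le_of_eq ?_) (aux_static Ca θ hCa hθ g hg_cont hg_per vbar hvbar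
        (fun x => ρ x t) (fun x => j x t) (fun x => w x t)
        (fun x => ρx x t) (fun x => jx x t) (fun x => wx x t) (fun x => wt x t)
        (fun x => dρx x t ht') (fun x => djx x t ht') (fun x => dwx x t ht')
        (aux_slice T _ cρx t ht') (aux_slice T _ cjx t ht') (aux_slice T _ cwx t ht')
        (aux_slice T _ cwt t ht')
        (hsol.periodic_rho t ht') (hsol.periodic_j t ht') (hw_per t ht')
        _ _ _ (aux_sup_le _ (aux_slice T _ cwx t ht') (pwx t ht'))
        (aux_sup_le _ (aux_slice T _ cwt t ht') (pwt t ht'))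
        (aux_sup_le _ (aux_slice T (fun x s => 1 - w x s) c1w t ht') (p1w t ht'))
        (mass_rho t ht') (mass_j t ht') Q hQ hQsmall (henergy t ht')
        (fun x => ρ x t * conv1 a (fun y => j y t) x - j x t * conv1 a (fun y => ρ y t) x)
        (fun x => by rw [ha]))
      refine intervalIntegral.integral_congr fun x _ => ?_
      simp only [ejt x t ht', eρt x t ht']
      ring
  -- Gronwall
  choose! R' hR1 hR2 using dR
  intro t ht
  have hsub : Set.Icc 0 t ⊆ Set.Icc 0 T := Set.Icc_subset_Icc_right ht.2
  have main := intervalIntegral.sub_le_integral_of_hasDeriv_right_of_le ht.1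
    (g := fun s => Real.exp (Ca * s) * R s)
    (g' := fun s => Real.exp (Ca * s) * Ca * R s + Real.exp (Ca * s) * R' s)
    (φ := fun s => Real.exp (Ca * s) * betaT s) ?_ ?_ ?_ ?_
  · simp only [mul_zero, Real.exp_zero, one_mul] at main
    have h1 : Real.exp (-Ca * t) * Real.exp (Ca * t) = 1 := by
      rw [← Real.exp_add]; simp
    have h2 := mul_le_mul_of_nonneg_left main (Real.exp_pos (-Ca * t)).le
    have h3 : Real.exp (-Ca * t) * (Real.exp (Ca * t) * R t) = R t := by
      rw [← mul_assoc, h1, one_mul]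
    rw [mul_sub, h3] at h2
    linarith
  · have := cR.mono hsub
    fun_prop
  · intro s hs
    have hs' : s ∈ Set.Ioo 0 T := ⟨hs.1, hs.2.trans_le ht.2⟩
    have h1 : HasDerivAt (fun s => Real.exp (Ca * s)) (Real.exp (Ca * s) * Ca) s := by
      simpa using ((hasDerivAt_id s).const_mul Ca).exp
    exact (h1.fun_mul (hR1 s hs')).hasDerivWithinAt
  · have := cbeta.mono hsub
    exact ContinuousOn.integrableOn_Icc (by fun_prop)
  · intro s hs
    have hs' : s ∈ Set.Ioo 0 T := ⟨hs.1, hs.2.trans_le ht.2⟩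
    have := mul_le_mul_of_nonneg_left (hR2 s hs') (Real.exp_pos (Ca * s)).le
    nlinarith
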